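/- arXiv:quant-ph/0507190 — 2 statements merged into one kernel-verified Lean document; each statement's English description precedes it below -/
import Mathlib

section
/- Let N, M, k ≥ 1 be integers. Then (1/N^(k+1)) · Σ_{x ∈ (ℤ/Nℤ)ᵏ} Σ_{w ∈ ℤ/Nℤ} (η^x_w)² = M^k/N + (1/N²) · Σ_{b ≠ c} gcd(b₁−c₁, …, b_k−c_k, N), where the last sum is over all ordered pairs b, c ∈ {0,…,M−1}ᵏ with b ≠ c. -/
/-- `η^x_w` is the number of `b ∈ {0,…,M-1}^k` with `b₁x₁ + ⋯ + b_kx_k ≡ w (mod N)`. -/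
def eta (N M k : ℕ) (x : Fin k → ZMod N) (w : ZMod N) : ℕ :=
  (Finset.univ.filter
    (fun b : Fin k → Fin M => ∑ i, ((b i : ℕ) : ZMod N) * x i = w)).card

/-- The additive subgroup of `ZMod N` generated by `d` has `N / gcd(d, N)` elements. -/
theorem card_zmultiples_intCast_mul_gcd (N : ℕ) [NeZero N] (d : ℤ) :
    Nat.card (AddSubgroup.zmultiples (d : ZMod N)) * Int.gcd d N = N := by
  have h : AddSubgroup.zmultiples (d : ZMod N) =
      AddSubgroup.zmultiples ((d.natAbs : ℕ) : ZMod N) := by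
    rcases Int.natAbs_eq d with hd | hd
    · conv_lhs => rw [hd]
      simp only [Int.cast_natCast]
    · conv_lhs => rw [hd]
      simp only [Int.cast_neg, Int.cast_natCast, AddSubgroup.zmultiples_neg]
  rw [h, Nat.card_zmultiples, ZMod.addOrderOf_coe _ (NeZero.ne N), Int.gcd_def, Int.natAbs_natCast,
    Nat.gcd_comm d.natAbs]
  exact Nat.div_mul_cancel (Nat.gcd_dvd_left _ _)

/-- The number of solutions of a homogeneous linear equation over `ZMod N`. -/
theorem card_linear_solutions_mul {ι : Type*} [Fintype ι] [DecidableEq ι] (N : ℕ) [NeZero N]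
    (a : ι → ℤ) :
    (Finset.univ.filter (fun x : ι → ZMod N => ∑ i, (a i : ZMod N) * x i = 0)).card * N =
      N ^ Fintype.card ι * Int.gcd (Finset.univ.gcd a) N := by
  let φ : (ι → ZMod N) →+ ZMod N :=
    { toFun := fun x => ∑ i, (a i : ZMod N) * x i
      map_zero' := by simp
      map_add' := fun x y => by simp [mul_add, Finset.sum_add_distrib] }
  have hrange : φ.range = AddSubgroup.zmultiples ((Finset.univ.gcd a : ℤ) : ZMod N) := by
    apply le_antisymm
    · rintro _ ⟨x, rfl⟩
      refine AddSubgroup.sum_mem _ fun i _ => ?_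
      obtain ⟨c, hc⟩ := Finset.gcd_dvd (f := a) (Finset.mem_univ i)
      obtain ⟨y, hy⟩ := ZMod.intCast_surjective (x i)
      refine AddSubgroup.mem_zmultiples_iff.mpr ⟨c * y, ?_⟩
      rw [← hy, zsmul_eq_mul]
      conv_rhs => rw [hc]
      push_cast
      ring
    · rw [AddSubgroup.zmultiples_le]
      obtain ⟨g, hg⟩ := Finset.gcd_eq_sum_mul (Finset.univ : Finset ι) a
      refine ⟨fun i => (g i : ZMod N), ?_⟩
      change ∑ i, (a i : ZMod N) * (g i : ZMod N) = _
      rw [hg]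
      push_cast
      rfl
  have hker : (Finset.univ.filter
      (fun x : ι → ZMod N => ∑ i, (a i : ZMod N) * x i = 0)).card = Nat.card φ.ker := by
    rw [← Fintype.card_subtype, ← Nat.card_eq_fintype_card]
    rfl
  have hcard : Nat.card φ.ker * Nat.card φ.range = N ^ Fintype.card ι := by
    rw [← AddSubgroup.index_ker, AddSubgroup.card_mul_index]
    simp
  rw [hker, ← hcard, mul_assoc, hrange, card_zmultiples_intCast_mul_gcd]

/-- The second moment of the fibre sizes of `f` counts the pairs on which `f` agrees. -/
theorem sum_card_fiber_sq {α β : Type*} [Fintype α] [Fintype β] [DecidableEq β] (f : α → β) :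
    ∑ w, (Finset.univ.filter (fun b => f b = w)).card ^ 2 =
      (Finset.univ.filter (fun p : α × α => f p.1 = f p.2)).card := by
  rw [Finset.card_eq_sum_card_fiberwise (f := fun p => f p.2) (t := Finset.univ) (by simp)]
  refine Finset.sum_congr rfl fun w _ => ?_
  rw [sq, ← Finset.card_product]
  congr 1
  ext p
  simp only [Finset.mem_product, Finset.mem_filter, Finset.mem_univ, true_and]
  constructor
  · rintro ⟨h, h'⟩
    exact ⟨h.trans h'.symm, h'⟩
  · rintro ⟨h, h'⟩
    exact ⟨h.trans h', h'⟩

/-- The second moment of `eta`, summed over all `x`, with denominators cleared. -/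
theorem sum_eta_sq_mul (N M k : ℕ) [NeZero N] :
    (∑ x : Fin k → ZMod N, ∑ w : ZMod N, eta N M k x w ^ 2) * N =
      N ^ k * ∑ p : (Fin k → Fin M) × (Fin k → Fin M),
        Int.gcd (Finset.univ.gcd (fun i => (p.1 i : ℤ) - (p.2 i : ℤ))) (N : ℤ) := by
  simp only [eta, sum_card_fiber_sq]
  simp only [Finset.card_filter]
  rw [Finset.sum_comm, Finset.sum_mul, Finset.mul_sum]
  refine Finset.sum_congr rfl fun p _ => ?_
  have h := card_linear_solutions_mul N (fun i => (p.1 i : ℤ) - (p.2 i : ℤ))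
  rw [Fintype.card_fin] at h
  rw [← h, Finset.card_filter]
  congr 1
  refine Finset.sum_congr rfl fun x _ => ?_
  simp [sub_mul, Finset.sum_sub_distrib, sub_eq_zero]


/-- The second moment of `η^x_w` equals
`M^k/N + (1/N²) ∑_{b ≠ c} gcd(b₁-c₁, …, b_k-c_k, N)`, where the sum is over ordered
pairs `b, c ∈ {0,…,M-1}^k` with `b ≠ c`. -/
theorem eta_second_moment_eq (N M k : ℕ) [NeZero N] (hM : 1 ≤ M) (hk : 1 ≤ k) :
    (1 / (N : ℝ) ^ (k + 1)) *
        ∑ x : Fin k → ZMod N, ∑ w : ZMod N, (eta N M k x w : ℝ) ^ 2 =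
      (M : ℝ) ^ k / N + (1 / (N : ℝ) ^ 2) *
        ∑ p ∈ (Finset.univ : Finset ((Fin k → Fin M) × (Fin k → Fin M))).filter
            (fun p => p.1 ≠ p.2),
          (Int.gcd (Finset.univ.gcd (fun i => (p.1 i : ℤ) - (p.2 i : ℤ))) (N : ℤ) : ℝ) := by
  have hN : (N : ℝ) ≠ 0 := Nat.cast_ne_zero.mpr (NeZero.ne N)
  have h := congrArg (Nat.cast : ℕ → ℝ) (sum_eta_sq_mul N M k)
  push_cast at h
  have hdiag : ∑ p ∈ (Finset.univ : Finset ((Fin k → Fin M) × (Fin k → Fin M))).filter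
      (fun p => ¬ p.1 ≠ p.2),
      (Int.gcd (Finset.univ.gcd (fun i => (p.1 i : ℤ) - (p.2 i : ℤ))) (N : ℤ) : ℝ) =
        (M : ℝ) ^ k * N := by
    have hconst : ∀ p ∈ (Finset.univ : Finset ((Fin k → Fin M) × (Fin k → Fin M))).filter
        (fun p => ¬ p.1 ≠ p.2),
        (Int.gcd (Finset.univ.gcd (fun i => (p.1 i : ℤ) - (p.2 i : ℤ))) (N : ℤ) : ℝ) = N := by
      intro p hp
      have hp' : p.1 = p.2 := by simpa using hp
      have hzero : Finset.univ.gcd (fun i => (p.1 i : ℤ) - (p.2 i : ℤ)) = 0 :=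
        Finset.gcd_eq_zero_iff.mpr fun i _ => by simp [hp']
      simp [hzero]
    rw [Finset.sum_congr rfl hconst, Finset.sum_const, nsmul_eq_mul]
    congr 1
    have hcard : ((Finset.univ : Finset ((Fin k → Fin M) × (Fin k → Fin M))).filter
        (fun p => ¬ p.1 ≠ p.2)) = (Finset.univ : Finset (Fin k → Fin M)).diag := by
      ext p
      simp
    rw [hcard, Finset.diag_card]
    simp
  rw [← Finset.sum_filter_add_sum_filter_not Finset.univ
    (fun p : (Fin k → Fin M) × (Fin k → Fin M) => p.1 ≠ p.2), hdiag] at h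
  rw [← eq_div_iff hN] at h
  rw [h]
  field_simp
  ring
end

section
/- Fix an integer k ≥ 3 and set M = M(N) := ⌊N^(1/k)⌋, μ := M^k/N, and σ² := (1/N^(k+1)) · Σ_{x,w} (η^x_w)² − μ². Then for every ε > 0 there exists N₀ such that for all N ≥ N₀, one has σ² ≤ π²/6 + ε and σ² ≥ 1 − ε. -/
/-- `Mfl k N = ⌊N^(1/k)⌋`, the integer part of the real `k`-th root of `N`. -/
noncomputable def Mfl (k N : ℕ) : ℕ := Nat.floor ((N : ℝ) ^ ((1 : ℝ) / k))

open Finset Filter Topology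

theorem exists_dvd_card_linear_kernel (N n : ℕ) [NeZero N] (d : Fin (n + 1) → ℤ) :
    ∃ h : ℕ, 0 < h ∧ (∀ i, (h : ℤ) ∣ d i) ∧
      #{x : Fin (n + 1) → ZMod N | ∑ i, (d i : ZMod N) * x i = 0} = N ^ n * h := by
  let f : (Fin (n + 1) → ZMod N) →+ ZMod N :=
    { toFun := fun x => ∑ i, (d i : ZMod N) * x i
      map_zero' := by simp
      map_add' := by intro x y; simp [mul_add, sum_add_distrib] }
  have hN : 0 < N := Nat.pos_of_ne_zero (NeZero.ne N)
  have hker : #{x : Fin (n + 1) → ZMod N | ∑ i, (d i : ZMod N) * x i = 0} = Nat.card f.ker := by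
    rw [Nat.card_eq_fintype_card, ← Fintype.card_subtype]
    exact Fintype.card_congr (Equiv.refl _)
  have hmul : Nat.card f.range * Nat.card f.ker = N ^ (n + 1) := by
    have h1 := f.ker.card_mul_index
    rw [AddSubgroup.index_ker] at h1
    rw [mul_comm, h1]
    simp
  have hidx := f.range.card_mul_index
  rw [Nat.card_zmod] at hidx
  have hr : 0 < Nat.card f.range := Nat.pos_of_mul_pos_right (hidx ▸ hN)
  refine ⟨f.range.index, Nat.pos_of_ne_zero fun h0 => by simp [h0] at hidx; omega, ?_, ?_⟩
  · intro i
    have hmem : ((d i : ℤ) : ZMod N) ∈ f.range := ⟨Pi.single i 1, by simp [f, Pi.single_apply]⟩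
    have h0 : Nat.card f.range • ((d i : ℤ) : ZMod N) = 0 := by
      have := congrArg Subtype.val (card_nsmul_eq_zero' (G := f.range) (x := ⟨_, hmem⟩))
      simpa using this
    have h1 : ((Nat.card f.range * d i : ℤ) : ZMod N) = 0 := by
      rw [nsmul_eq_mul] at h0
      push_cast
      exact h0
    rw [ZMod.intCast_zmod_eq_zero_iff_dvd] at h1
    have h2 : (Nat.card f.range : ℤ) * f.range.index ∣ Nat.card f.range * d i := by
      have : ((Nat.card f.range * f.range.index : ℕ) : ℤ) ∣ Nat.card f.range * d i := by
        rw [hidx]; exact h1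
      exact_mod_cast this
    exact Int.dvd_of_mul_dvd_mul_left (by exact_mod_cast hr.ne') h2
  · rw [hker]
    refine Nat.eq_of_mul_eq_mul_left hr ?_
    rw [hmul, pow_succ]
    nth_rw 2 [← hidx]
    ring

/-- The number of `x` at which the linear forms with coefficient vectors `b` and `b'` agree. -/
def agreeCount (N M k : ℕ) [NeZero N] (b b' : Fin k → Fin M) : ℕ :=
  #{x : Fin k → ZMod N |
    ∑ i, ((b i : ℕ) : ZMod N) * x i = ∑ i, ((b' i : ℕ) : ZMod N) * x i}

theorem sum_eta_sq (N M k : ℕ) [NeZero N] :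
    ∑ x : Fin k → ZMod N, ∑ w : ZMod N, (eta N M k x w : ℝ) ^ 2 =
      ∑ b : Fin k → Fin M, ∑ b' : Fin k → Fin M, (agreeCount N M k b b' : ℝ) := by
  have h (x : Fin k → ZMod N) : ∑ w : ZMod N, (eta N M k x w : ℝ) ^ 2 =
      ∑ b : Fin k → Fin M, ∑ b' : Fin k → Fin M,
        if ∑ i, ((b i : ℕ) : ZMod N) * x i = ∑ i, ((b' i : ℕ) : ZMod N) * x i
          then (1 : ℝ) else 0 := by
    simp only [eta, card_filter, Nat.cast_sum, Nat.cast_ite, Nat.cast_one, Nat.cast_zero, sq,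
      sum_mul_sum]
    rw [sum_comm]
    refine sum_congr rfl fun b _ => ?_
    rw [sum_comm]
    refine sum_congr rfl fun b' _ => ?_
    simp [eq_comm]
  simp only [h, agreeCount, card_filter, Nat.cast_sum, Nat.cast_ite, Nat.cast_one, Nat.cast_zero]
  rw [sum_comm]
  refine sum_congr rfl fun b _ => sum_comm

theorem agreeCount_self (N M k : ℕ) [NeZero N] (b : Fin k → Fin M) :
    agreeCount N M k b b = N ^ k := by
  simp [agreeCount]

theorem exists_dvd_agreeCount (N M n : ℕ) [NeZero N] (b b' : Fin (n + 1) → Fin M) :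
    ∃ h : ℕ, 0 < h ∧ (∀ i, (b' i : ℕ) ≡ b i [MOD h]) ∧
      agreeCount N M (n + 1) b b' = N ^ n * h := by
  obtain ⟨h, hpos, hd, hc⟩ :=
    exists_dvd_card_linear_kernel N n (fun i => ((b i : ℕ) : ℤ) - ((b' i : ℕ) : ℤ))
  refine ⟨h, hpos, fun i => (Nat.modEq_iff_dvd).2 (hd i), ?_⟩
  rw [← hc, agreeCount]
  congr 1
  ext x
  simp [sub_mul, sum_sub_distrib, sub_eq_zero]

theorem le_agreeCount (N M n : ℕ) [NeZero N] (b b' : Fin (n + 1) → Fin M) :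
    (N : ℝ) ^ n * (1 + if b = b' then (N : ℝ) - 1 else 0) ≤ agreeCount N M (n + 1) b b' := by
  split_ifs with hb
  · subst hb
    rw [agreeCount_self]
    push_cast
    exact le_of_eq (by ring)
  · obtain ⟨h, hpos, -, hc⟩ := exists_dvd_agreeCount N M n b b'
    rw [hc]
    push_cast
    have : (1 : ℝ) ≤ h := by exact_mod_cast hpos
    gcongr
    simpa using this

theorem agreeCount_le (N M n : ℕ) [NeZero N] (b b' : Fin (n + 1) → Fin M) :
    (agreeCount N M (n + 1) b b' : ℝ) ≤
      (N : ℝ) ^ n * (1 + (if b = b' then (N : ℝ) - 1 else 0) +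
        ∑ g ∈ Ico 2 M, if ∀ i, (b' i : ℕ) ≡ b i [MOD g] then (g : ℝ) else 0) := by
  have hnn : ∀ g ∈ Ico 2 M,
      (0 : ℝ) ≤ if ∀ i, (b' i : ℕ) ≡ b i [MOD g] then (g : ℝ) else 0 := by
    intro g _; positivity
  have hs := sum_nonneg hnn
  split_ifs with hb
  · subst hb
    rw [agreeCount_self]
    push_cast
    calc (N : ℝ) ^ (n + 1) = N ^ n * (1 + (N - 1) + 0) := by ring
      _ ≤ _ := by gcongr
  · obtain ⟨h, hpos, hd, hc⟩ := exists_dvd_agreeCount N M n b b'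
    rw [hc]
    push_cast
    gcongr
    rcases Nat.lt_or_ge h 2 with h2 | h2
    · have : h = 1 := by omega
      subst this
      simpa using hs
    · have hM : h < M := by
        by_contra! hM
        refine hb (funext fun i => Fin.ext ?_)
        exact ((hd i).eq_of_lt_of_lt ((b' i).2.trans_le hM) ((b i).2.trans_le hM)).symm
      have := single_le_sum hnn (mem_Ico.2 ⟨h2, hM⟩)
      rw [if_pos hd] at this
      linarith

theorem card_modEq_le (M g : ℕ) (hg : 0 < g) (v : ℕ) :
    #{a : Fin M | (a : ℕ) ≡ v [MOD g]} ≤ M / g + 1 := by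
  have h := Nat.count_modEq_card M hg v
  rw [Nat.count_eq_card_filter_range] at h
  rw [← card_map Fin.valEmbedding]
  calc _ ≤ #{x ∈ range M | x ≡ v [MOD g]} := by
        refine card_le_card fun x hx => ?_
        simp only [Finset.mem_map, mem_filter, mem_univ, true_and, Fin.valEmbedding_apply] at hx
        obtain ⟨a, ha, rfl⟩ := hx
        simpa using ha
    _ ≤ _ := by rw [h]; gcongr; split_ifs <;> simp

theorem card_pi_modEq_le (M k g : ℕ) (hg : 0 < g) (b : Fin k → Fin M) :
    #{b' : Fin k → Fin M | ∀ i, (b' i : ℕ) ≡ b i [MOD g]} ≤ (M / g + 1) ^ k := by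
  have h : ({b' : Fin k → Fin M | ∀ i, (b' i : ℕ) ≡ b i [MOD g]} : Finset _) =
      Fintype.piFinset fun i => ({a : Fin M | (a : ℕ) ≡ b i [MOD g]} : Finset _) := by
    ext; simp
  rw [h, Fintype.card_piFinset]
  exact (prod_le_pow_card _ _ _ fun i _ => card_modEq_le M g hg _).trans (by simp)

theorem sum_one_add_diag (N M k : ℕ) :
    ∑ b : Fin k → Fin M, ∑ b' : Fin k → Fin M, (1 + if b = b' then (N : ℝ) - 1 else 0) =
      ((M : ℝ) ^ k) ^ 2 + M ^ k * (N - 1) := by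
  simp [sum_add_distrib]
  ring

theorem le_sum_eta_sq (N M n : ℕ) [NeZero N] :
    (N : ℝ) ^ n * (((M : ℝ) ^ (n + 1)) ^ 2 + M ^ (n + 1) * (N - 1)) ≤
      ∑ x : Fin (n + 1) → ZMod N, ∑ w : ZMod N, (eta N M (n + 1) x w : ℝ) ^ 2 := by
  rw [sum_eta_sq, ← sum_one_add_diag]
  simp only [mul_sum]
  exact sum_le_sum fun b _ => sum_le_sum fun b' _ => le_agreeCount N M n b b'

theorem sum_eta_sq_le (N M n : ℕ) [NeZero N] :
    ∑ x : Fin (n + 1) → ZMod N, ∑ w : ZMod N, (eta N M (n + 1) x w : ℝ) ^ 2 ≤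
      (N : ℝ) ^ n * (((M : ℝ) ^ (n + 1)) ^ 2 + M ^ (n + 1) * (N - 1) +
        ∑ g ∈ Ico 2 M, (g : ℝ) * (M ^ (n + 1) * (M / g + 1) ^ (n + 1))) := by
  rw [sum_eta_sq, ← sum_one_add_diag]
  calc _ ≤ ∑ b : Fin (n + 1) → Fin M, ∑ b' : Fin (n + 1) → Fin M,
        (N : ℝ) ^ n * (1 + (if b = b' then (N : ℝ) - 1 else 0) +
        ∑ g ∈ Ico 2 M, if ∀ i, (b' i : ℕ) ≡ b i [MOD g] then (g : ℝ) else 0) :=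
        sum_le_sum fun b _ => sum_le_sum fun b' _ => agreeCount_le N M n b b'
    _ = (N : ℝ) ^ n * (∑ b : Fin (n + 1) → Fin M, ∑ b' : Fin (n + 1) → Fin M,
          (1 + (if b = b' then (N : ℝ) - 1 else 0)) +
        ∑ g ∈ Ico 2 M, ∑ b : Fin (n + 1) → Fin M, ∑ b' : Fin (n + 1) → Fin M,
          if ∀ i, (b' i : ℕ) ≡ b i [MOD g] then (g : ℝ) else 0) := by
        simp only [← mul_sum]
        congr 1
        rw [sum_comm (s := Ico 2 M), ← sum_add_distrib]
        refine sum_congr rfl fun b _ => ?_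
        rw [sum_comm (s := Ico 2 M), ← sum_add_distrib]
    _ ≤ _ := by
        gcongr with g hg
        have hg0 : 0 < g := by have := (mem_Ico.1 hg).1; omega
        have hb (b : Fin (n + 1) → Fin M) : ∑ b' : Fin (n + 1) → Fin M,
            (if ∀ i, (b' i : ℕ) ≡ b i [MOD g] then (g : ℝ) else 0) ≤
              g * ((M : ℝ) / g + 1) ^ (n + 1) := by
          rw [← sum_filter, sum_const, nsmul_eq_mul, mul_comm]
          gcongr
          calc _ ≤ (((M / g + 1) ^ (n + 1) : ℕ) : ℝ) := by
                exact_mod_cast card_pi_modEq_le M (n + 1) g hg0 b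
            _ ≤ _ := by
                push_cast
                gcongr
                exact Nat.cast_div_le
        calc _ ≤ ∑ b : Fin (n + 1) → Fin M, (g : ℝ) * ((M : ℝ) / g + 1) ^ (n + 1) :=
              sum_le_sum fun b _ => hb b
          _ = _ := by simp; ring

/-- The relative weight `g (1/g + 1/M)^3` of the modulus `g`, restricted to `2 ≤ g < M`. -/
noncomputable def modulusWeight (M g : ℕ) : ℝ :=
  if g ∈ Ico 2 M then (g : ℝ) * (1 / g + 1 / M) ^ 3 else 0

theorem tendsto_tsum_modulusWeight :
    Tendsto (fun M : ℕ => ∑' g, modulusWeight M g) atTop (𝓝 (Real.pi ^ 2 / 6 - 1)) := by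
  have hz : HasSum (fun g : ℕ => if 2 ≤ g then 1 / (g : ℝ) ^ 2 else 0) (Real.pi ^ 2 / 6 - 1) := by
    have h1 : HasSum (fun g : ℕ => if g = 1 then (1 : ℝ) else 0) 1 := hasSum_ite_eq 1 1
    refine Eq.subst (motive := fun f => HasSum f _) (funext fun g => ?_) (hasSum_zeta_two.sub h1)
    rcases g with _ | _ | g <;> simp
  rw [← hz.tsum_eq]
  refine tendsto_tsum_of_dominated_convergence (bound := fun g : ℕ => 8 * (1 / (g : ℝ) ^ 2))
    (hasSum_zeta_two.summable.mul_left 8) ?_ ?_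
  · intro g
    by_cases hg : 2 ≤ g
    · have hg0 : (g : ℝ) ≠ 0 := by positivity
      have hlim : Tendsto (fun M : ℕ => (g : ℝ) * (1 / g + 1 / M) ^ 3) atTop
          (𝓝 ((g : ℝ) * (1 / (g : ℝ) + 0) ^ 3)) :=
        ((tendsto_const_nhds.add tendsto_one_div_atTop_nhds_zero_nat).pow 3).const_mul _
      have he : (g : ℝ) * (1 / g + 0) ^ 3 = 1 / (g : ℝ) ^ 2 := by field_simp; simp
      rw [if_pos hg, ← he]
      refine hlim.congr' ?_
      filter_upwards [eventually_gt_atTop g] with M hM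
      simp [modulusWeight, hg, hM]
    · simp [modulusWeight, hg]
  · refine Eventually.of_forall fun M g => ?_
    unfold modulusWeight
    split_ifs with hg
    · obtain ⟨h2, hM⟩ := mem_Ico.1 hg
      have hg0 : (0 : ℝ) < g := by positivity
      have hle : 1 / (M : ℝ) ≤ 1 / g := by gcongr
      rw [Real.norm_of_nonneg (by positivity)]
      calc (g : ℝ) * (1 / g + 1 / M) ^ 3 ≤ g * (1 / g + 1 / g) ^ 3 := by gcongr
        _ = 8 * (1 / (g : ℝ) ^ 2) := by field_simp; norm_num
    · simp

theorem sum_modulus_le (M k : ℕ) (hk : 3 ≤ k) :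
    ∑ g ∈ Ico 2 M, (g : ℝ) * (M ^ k * (M / g + 1) ^ k) ≤
      ((M : ℝ) ^ k) ^ 2 * ∑' g, modulusWeight M g := by
  have ht : ∑' g, modulusWeight M g = ∑ g ∈ Ico 2 M, (g : ℝ) * (1 / g + 1 / M) ^ 3 := by
    rw [tsum_eq_sum (s := Ico 2 M) fun g hg => by simp only [modulusWeight, if_neg hg]]
    exact sum_congr rfl fun g hg => by simp only [modulusWeight, if_pos hg]
  rw [ht, mul_sum]
  refine sum_le_sum fun g hg => ?_
  obtain ⟨h2, hM⟩ := mem_Ico.1 hg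
  have hg2 : (2 : ℝ) ≤ g := by exact_mod_cast h2
  have hM2 : (2 : ℝ) ≤ M := by exact_mod_cast h2.trans hM.le
  have h1 : (1 : ℝ) / g + 1 / M ≤ 1 := by
    have : 1 / (g : ℝ) ≤ 1 / 2 := by gcongr
    have : 1 / (M : ℝ) ≤ 1 / 2 := by gcongr
    linarith
  have he : (M : ℝ) / g + 1 = M * (1 / g + 1 / M) := by field_simp
  have := pow_le_pow_of_le_one (by positivity) h1 hk
  calc (g : ℝ) * (M ^ k * (M / g + 1) ^ k)
      = ((M : ℝ) ^ k) ^ 2 * (g * (1 / g + 1 / M) ^ k) := by rw [he, mul_pow]; ring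
    _ ≤ _ := by gcongr

theorem tendsto_natCast_rpow_atTop (k : ℕ) (hk : 0 < k) :
    Tendsto (fun N : ℕ => (N : ℝ) ^ ((1 : ℝ) / k)) atTop atTop :=
  (tendsto_rpow_atTop (by positivity)).comp tendsto_natCast_atTop_atTop

theorem tendsto_Mfl (k : ℕ) (hk : 0 < k) : Tendsto (Mfl k) atTop atTop :=
  tendsto_nat_floor_atTop.comp (tendsto_natCast_rpow_atTop k hk)

theorem natCast_rpow_one_div_pow (k N : ℕ) (hk : 0 < k) :
    ((N : ℝ) ^ ((1 : ℝ) / k)) ^ k = N := by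
  rw [one_div]
  exact Real.rpow_inv_natCast_pow (by positivity) hk.ne'

theorem Mfl_pow_le (k N : ℕ) (hk : 0 < k) : (Mfl k N : ℝ) ^ k ≤ N := by
  rw [← natCast_rpow_one_div_pow k N hk]
  gcongr
  exact Nat.floor_le (by positivity)

theorem tendsto_Mfl_pow_div (k : ℕ) (hk : 0 < k) :
    Tendsto (fun N : ℕ => (Mfl k N : ℝ) ^ k / N) atTop (𝓝 1) := by
  have h := ((tendsto_nat_floor_div_atTop (R := ℝ)).comp (tendsto_natCast_rpow_atTop k hk)).pow k
  rw [one_pow] at h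
  refine h.congr fun N => ?_
  simp only [Function.comp, div_pow, natCast_rpow_one_div_pow k N hk, Mfl]

/-- The variance `σ² = E[η²] - μ²` of `η^x_w` (with `μ = M^k/N`, `M = ⌊N^(1/k)⌋`,
`k ≥ 3` fixed) satisfies `σ² ≤ π²/6 + ε` and `σ² ≥ 1 - ε` for all sufficiently
large `N`. -/
theorem eta_variance_bounds (k : ℕ) (hk : 3 ≤ k) (ε : ℝ) (hε : 0 < ε) :
    ∃ N₀ : ℕ, ∀ (N : ℕ) [NeZero N], N₀ ≤ N →
      ((1 / (N : ℝ) ^ (k + 1)) *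
            (∑ x : Fin k → ZMod N, ∑ w : ZMod N, (eta N (Mfl k N) k x w : ℝ) ^ 2) -
          ((Mfl k N : ℝ) ^ k / N) ^ 2 ≤ Real.pi ^ 2 / 6 + ε) ∧
      (1 - ε ≤ (1 / (N : ℝ) ^ (k + 1)) *
            (∑ x : Fin k → ZMod N, ∑ w : ZMod N, (eta N (Mfl k N) k x w : ℝ) ^ 2) -
          ((Mfl k N : ℝ) ^ k / N) ^ 2) := by
  have hk0 : 0 < k := by omega
  have hup : ∀ᶠ N : ℕ in atTop, ∑' g, modulusWeight (Mfl k N) g < Real.pi ^ 2 / 6 - 1 + ε :=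
    (tendsto_tsum_modulusWeight.comp (tendsto_Mfl k hk0)).eventually_lt_const (by linarith)
  have hlow : ∀ᶠ N : ℕ in atTop, 1 - ε < (Mfl k N : ℝ) ^ k / N * (1 - 1 / N) := by
    have h := (tendsto_Mfl_pow_div k hk0).mul
      (tendsto_one_div_atTop_nhds_zero_nat (𝕜 := ℝ) |>.const_sub 1)
    exact h.eventually_const_lt (by linarith)
  obtain ⟨N₀, hN₀⟩ := eventually_atTop.1 (hup.and hlow)
  refine ⟨N₀, fun N _ hN => ?_⟩
  obtain ⟨hU, hL⟩ := hN₀ N hN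
  have hNpos : (0 : ℝ) < N := by exact_mod_cast Nat.pos_of_ne_zero (NeZero.ne N)
  have hN1 : (1 : ℝ) ≤ N := by exact_mod_cast Nat.pos_of_ne_zero (NeZero.ne N)
  have hMle := Mfl_pow_le k N hk0
  have hsum := sum_modulus_le (Mfl k N) k hk
  obtain ⟨n, rfl⟩ : ∃ n, k = n + 1 := ⟨k - 1, by omega⟩
  generalize Mfl (n + 1) N = M at *
  have hlo := le_sum_eta_sq N M n
  have hhi := sum_eta_sq_le N M n
  set S := ∑ x : Fin (n + 1) → ZMod N, ∑ w : ZMod N, (eta N M (n + 1) x w : ℝ) ^ 2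
  set T := ∑' g, modulusWeight M g
  have hT0 : 0 ≤ T := tsum_nonneg fun g => by unfold modulusWeight; positivity
  set r := (M : ℝ) ^ (n + 1) / N with hr
  have hM : (M : ℝ) ^ (n + 1) = r * N := by rw [hr]; field_simp
  have hr0 : 0 ≤ r := by positivity
  have hr1 : r ≤ 1 := div_le_one_of_le₀ hMle hNpos.le
  have hnorm (A : ℝ) : 1 / (N : ℝ) ^ (n + 1 + 1) * (N ^ n * A) = A / N ^ 2 := by
    field_simp
    ring
  have hp : 0 ≤ 1 / (N : ℝ) ^ (n + 1 + 1) := by positivity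
  constructor
  · have h1 := mul_le_mul_of_nonneg_left
      (hhi.trans (mul_le_mul_of_nonneg_left (add_le_add_right hsum _) (by positivity))) hp
    rw [hnorm, hM] at h1
    have h2 : ((r * N) ^ 2 + r * N * (N - 1) + (r * N) ^ 2 * T) / (N : ℝ) ^ 2 =
        r ^ 2 + r * (1 - 1 / N) + r ^ 2 * T := by field_simp
    have h3 : r * (1 - 1 / N) ≤ 1 * 1 := by
      have : 0 ≤ 1 / (N : ℝ) := by positivity
      have : 1 / (N : ℝ) ≤ 1 := by rw [div_le_one hNpos]; exact hN1
      gcongr; linarith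
    have h4 : r ^ 2 * T ≤ 1 * T := by gcongr; exact pow_le_one₀ hr0 hr1
    linarith
  · have h1 := mul_le_mul_of_nonneg_left hlo hp
    rw [hnorm, hM] at h1
    have h2 : ((r * N) ^ 2 + r * N * (N - 1)) / (N : ℝ) ^ 2 = r ^ 2 + r * (1 - 1 / N) := by
      field_simp
    linarith
end
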